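/- arXiv:2008.12261 — 3 statements merged into one kernel-verified Lean document; each statement's English description precedes it below -/
import Mathlib

section
/- Let A be a torsion-free abelian group of finite rank whose endomorphism ring End(A) is centrally essential. Then A is faithful: for every proper right ideal I of End(A), the subgroup I·A generated by all elements φ(a) with φ ∈ I and a ∈ A is a proper subgroup of A. -/
open TensorProduct

/-- A ring `R` is *centrally essential* if for every nonzero `a : R` there exist
nonzero central elements `x, y` with `a * x = y`. -/
def IsCentrallyEssential (R : Type*) [Ring R] : Prop :=
  ∀ a : R, a ≠ 0 → ∃ x y : R, x ∈ Subring.center R ∧ y ∈ Subring.center R ∧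
    x ≠ 0 ∧ y ≠ 0 ∧ a * x = y

/-- An additive subgroup of a ring is a right ideal if it is closed under
right multiplication by arbitrary ring elements. -/
def IsRightIdeal {R : Type*} [Ring R] (I : AddSubgroup R) : Prop :=
  ∀ x ∈ I, ∀ r : R, x * r ∈ I

/-- If `I V = V` and every element of the right ideal `I` has a power acting on `V` through
`(I ∩ Z(E)) E`, then some element of `I` acts on `V` as the identity. -/
theorem exists_mem_forall_smul_eq_self {E V : Type*} [Ring E] [AddCommGroup V] [Module E V]
    [Module.Finite (Subring.center E) V] [Module.Finite E V]
    {I : AddSubgroup E} (hI : IsRightIdeal I)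
    (hIV : AddSubgroup.closure {v : V | ∃ x ∈ I, ∃ u : V, v = x • u} = ⊤)
    (h : ∀ x ∈ I, ∃ m : ℕ, ∃ c ∈ Subring.center E, c ∈ I ∧ ∃ e : E, ∀ v : V,
      x ^ m • v = c • e • v) :
    ∃ c ∈ I, ∀ v : V, c • v = v := by
  let J : Ideal (Subring.center E) :=
    { carrier := {c | (c : E) ∈ I}
      add_mem' := fun ha hb => I.add_mem ha hb
      zero_mem' := I.zero_mem
      smul_mem' := fun c x hx => by
        have := hI _ hx c
        rw [Subring.mem_center_iff.1 x.2 c |>.symm] at this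
        exact this }
  have hJ (c : Subring.center E) : c ∈ J ↔ (c : E) ∈ I := Iff.rfl
  let U : Submodule E V :=
    { (J • (⊤ : Submodule (Subring.center E) V)).toAddSubmonoid with
      smul_mem' := fun e v hv => by
        change v ∈ J • (⊤ : Submodule (Subring.center E) V) at hv
        change e • v ∈ J • (⊤ : Submodule (Subring.center E) V)
        induction hv using Submodule.smul_induction_on' with
        | smul c hc v _ =>
          have : e • c • v = c • e • v := by
            change e • (c : E) • v = (c : E) • e • v
            rw [smul_smul, smul_smul, Subring.mem_center_iff.1 c.2 e]
          rw [this]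
          exact Submodule.smul_mem_smul hc trivial
        | add x _ y _ hx hy => rw [smul_add]; exact add_mem hx hy }
  have hU (c : E) (hc : c ∈ Subring.center E) (hcI : c ∈ I) (v : V) : c • v ∈ U := by
    change (⟨c, hc⟩ : Subring.center E) • v ∈ J • (⊤ : Submodule (Subring.center E) V)
    exact Submodule.smul_mem_smul hcI trivial
  have hUtop : U = ⊤ := by
    by_contra hne
    obtain ⟨W, hW, hUW⟩ := (eq_top_or_exists_le_coatom U).resolve_left hne
    obtain ⟨x, hx, u, hxu⟩ : ∃ x ∈ I, ∃ u : V, x • u ∉ W := by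
      by_contra! hcon
      refine hW.1 (eq_top_iff.2 fun v _ => ?_)
      have hle : AddSubgroup.closure {v : V | ∃ x ∈ I, ∃ u : V, v = x • u} ≤ W.toAddSubgroup := by
        rw [AddSubgroup.closure_le]
        rintro _ ⟨x, hx, u, rfl⟩
        exact hcon x hx u
      exact hle (hIV ▸ AddSubgroup.mem_top v)
    have hsup : Submodule.span E {x • u} ⊔ W = ⊤ := by
      refine hW.2 _ (lt_of_le_of_ne le_sup_right fun heq => hxu ?_)
      rw [heq]
      exact Submodule.mem_sup_left (Submodule.mem_span_singleton_self _)
    obtain ⟨y, w, hw, hyw⟩ : ∃ y : E, ∃ w ∈ W, y • x • u + w = u := by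
      have : u ∈ Submodule.span E {x • u} ⊔ W := hsup ▸ Submodule.mem_top
      obtain ⟨a, ha, w, hw, haw⟩ := Submodule.mem_sup.1 this
      obtain ⟨y, rfl⟩ := Submodule.mem_span_singleton.1 ha
      exact ⟨y, w, hw, haw⟩
    have hpow (k : ℕ) : u - (y * x) ^ k • u ∈ W := by
      induction k with
      | zero => simp
      | succ k ih =>
        have h1 : u - (y * x) ^ (k + 1) • u = w + (y * x) • (u - (y * x) ^ k • u) := by
          rw [smul_sub, smul_smul, ← pow_succ', mul_smul]
          nth_rewrite 1 [← hyw]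
          abel
        rw [h1]
        exact W.add_mem hw (W.smul_mem _ ih)
    obtain ⟨m, c, hc, hcI, e, he⟩ := h (x * y) (hI x hx y)
    have hu : u ∈ W := by
      have h1 : (y * x) ^ (m + 1) • u ∈ W := by
        have h2 : (y * x) ^ (m + 1) = y * ((x * y) ^ m * x) := by
          rw [pow_succ, ← mul_assoc, ← mul_assoc, mul_pow_mul]
        rw [h2, mul_smul, mul_smul, he]
        exact W.smul_mem _ (hUW (hU c hc hcI _))
      simpa using W.add_mem (hpow (m + 1)) h1
    exact hxu (W.smul_mem x hu)
  obtain ⟨r, hr, hrv⟩ := Submodule.exists_sub_one_mem_and_smul_eq_zero_of_fg_of_le_smul J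
    (⊤ : Submodule (Subring.center E) V) Module.Finite.fg_top
    (fun v _ => (hUtop ▸ Submodule.mem_top : v ∈ U))
  refine ⟨1 - r, ?_, fun v => ?_⟩
  · have : ((r - 1 : Subring.center E) : E) ∈ I := hr
    simpa using I.neg_mem this
  · have : (r : E) • v = 0 := hrv v trivial
    rw [sub_smul, this, one_smul, sub_zero]

theorem aeval_mulRight_apply {K R : Type*} [CommRing K] [Ring R] [Algebra K R] (s r : R)
    (p : Polynomial K) :
    Polynomial.aeval (LinearMap.mulRight K s) p r = r * Polynomial.aeval s p := by
  induction p using Polynomial.induction_on' with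
  | add p q hp hq => simp [hp, hq, mul_add]
  | monomial n a =>
    simp [Polynomial.aeval_monomial, LinearMap.pow_mulRight, Algebra.algebraMap_eq_smul_one]

/-- The operator `[s, -]` is semisimple, so its image meets its kernel trivially; but a nonzero image
would contain a nonzero central element. -/
theorem IsCentrallyEssential.mem_center_of_isSemisimple {K R : Type*} [Field K] [PerfectField K]
    [Ring R] [Algebra K R] [FiniteDimensional K R] (hR : IsCentrallyEssential R) {s : R}
    (hs : Module.End.IsSemisimple (LinearMap.mulLeft K s)) : s ∈ Subring.center R := by
  have hmin : Polynomial.aeval s (minpoly K (LinearMap.mulLeft K s)) = 0 := by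
    have h := minpoly.aeval K (LinearMap.mulLeft K s)
    change Polynomial.aeval (Algebra.lmul K R s) _ = 0 at h
    rw [Polynomial.aeval_algHom_apply] at h
    exact Algebra.lmul_injective (by rw [h, map_zero])
  have hs' : Module.End.IsSemisimple (LinearMap.mulRight K s) := by
    refine Module.End.isSemisimple_of_squarefree_aeval_eq_zero hs.minpoly_squarefree ?_
    ext r
    rw [aeval_mulRight_apply, hmin, mul_zero, LinearMap.zero_apply]
  have had := hs.sub_of_commute (LinearMap.ext fun r => (mul_assoc s r s).symm) hs'
  set D := LinearMap.mulLeft K s - LinearMap.mulRight K s with hD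
  have hDapp (r : R) : D r = s * r - r * s := rfl
  rw [Subring.mem_center_iff]
  intro y
  by_contra hne
  obtain ⟨x, z, hx, hz, -, hz0, hxz⟩ := hR (D y) (by rw [hDapp, sub_ne_zero]; exact Ne.symm hne)
  rw [Subring.mem_center_iff] at hx hz
  have hDz : D z = 0 := by rw [hDapp, hz, sub_self]
  have hzD : z = D (y * x) := by
    rw [← hxz, hDapp, hDapp, sub_mul, mul_assoc, mul_assoc, mul_assoc, hx s]
  obtain ⟨q, hq, hcompl⟩ := Module.End.isSemisimple_iff.1 had (LinearMap.ker D)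
    (fun r hr => by rw [Submodule.mem_comap, LinearMap.mem_ker.1 hr]; exact zero_mem _)
  obtain ⟨a, ha, b, hb, hab⟩ := Submodule.mem_sup.1
    (hcompl.sup_eq_top ▸ Submodule.mem_top : y * x ∈ LinearMap.ker D ⊔ q)
  have hzq : z ∈ q := by
    rw [hzD, ← hab, map_add, LinearMap.mem_ker.1 ha, zero_add]
    exact hq hb
  exact hz0 (Submodule.disjoint_def.1 hcompl.disjoint z hDz hzq)

/-- The Jordan–Chevalley decomposition in a centrally essential algebra has central semisimple
part. -/
theorem IsCentrallyEssential.exists_eq_add_isNilpotent (K : Type*) {R : Type*} [Field K]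
    [PerfectField K] [Ring R] [Algebra K R] [FiniteDimensional K R] (hR : IsCentrallyEssential R)
    (x : R) :
    ∃ s ∈ Subring.center R, ∃ n, IsNilpotent n ∧ x = s + n := by
  obtain ⟨n, hn, s, hs, hnil, hss, hx⟩ :=
    Module.End.exists_isNilpotent_isSemisimple (f := LinearMap.mulLeft K x)
  have key : ∀ f ∈ Algebra.adjoin K {LinearMap.mulLeft K x}, ∃ r : R, LinearMap.mulLeft K r = f := by
    intro f hf
    have hle : Algebra.adjoin K {LinearMap.mulLeft K x} ≤ (Algebra.lmul K R).range :=
      Algebra.adjoin_le (by rintro _ rfl; exact ⟨x, rfl⟩)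
    exact hle hf
  obtain ⟨n, rfl⟩ := key n hn
  obtain ⟨s, rfl⟩ := key s hs
  refine ⟨s, hR.mem_center_of_isSemisimple hss, n, ?_, ?_⟩
  · obtain ⟨d, hd⟩ := hnil
    refine ⟨d, ?_⟩
    simpa [LinearMap.pow_mulLeft] using LinearMap.congr_fun hd 1
  · simpa [add_comm] using LinearMap.congr_fun hx 1

theorem mem_center_of_map_mem_center {E R : Type*} [Ring E] [Ring R] {j : E →+* R}
    (hj : Function.Injective j) {x : E}
    (hx : j x ∈ Subring.center R) : x ∈ Subring.center E := by
  rw [Subring.mem_center_iff] at hx ⊢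
  intro y
  apply hj
  rw [map_mul, map_mul, hx]

theorem exists_pow_eq_mul_of_isNilpotent {R : Type*} [Ring R] {x s n : R} (hs : s ∈ Subring.center R)
    (hn : IsNilpotent n) (hx : x = s + n) :
    ∃ m : ℕ, ∃ c ∈ Subring.center R, (∃ r, c = x * r) ∧ ∃ e, x ^ m = c * e := by
  obtain ⟨d, hd⟩ := hn
  have hsn : Commute s n := (Subring.mem_center_iff.1 hs n).symm
  refine ⟨d * d, s ^ d, pow_mem hs d, ⟨∑ i ∈ Finset.range d, s ^ i * (-n) ^ (d - 1 - i), ?_⟩,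
    (∑ i ∈ Finset.range d, x ^ i * n ^ (d - 1 - i)) ^ d, ?_⟩
  · have := (hsn.neg_right).mul_geom_sum₂ d
    rw [neg_pow n, hd, mul_zero, sub_zero, sub_neg_eq_add, ← hx] at this
    exact this.symm
  · have hxn : Commute x n := hx ▸ hsn.add_left (Commute.refl n)
    have := hxn.mul_geom_sum₂ d
    rw [hd, sub_zero, hx, add_sub_cancel_right, ← hx] at this
    rw [pow_mul, ← this, Commute.mul_pow (Subring.mem_center_iff.1 hs _).symm]

/-- The elements of `R` with a nonzero multiple in the image of `I` under `j`. -/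
def fractionSubgroup {E R : Type*} [Ring E] [Ring R] (j : E →+* R) (I : AddSubgroup E) :
    AddSubgroup R where
  carrier := {f | ∃ k : ℕ, k ≠ 0 ∧ ∃ φ ∈ I, (k : R) * f = j φ}
  zero_mem' := ⟨1, one_ne_zero, 0, I.zero_mem, by rw [mul_zero, map_zero]⟩
  neg_mem' := by
    rintro f ⟨k, hk, φ, hφ, h⟩
    exact ⟨k, hk, -φ, I.neg_mem hφ, by rw [mul_neg, h, map_neg]⟩
  add_mem' := by
    rintro f g ⟨k, hk, φ, hφ, hf⟩ ⟨l, hl, ψ, hψ, hg⟩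
    refine ⟨k * l, mul_ne_zero hk hl, l • φ + k • ψ,
      I.add_mem (I.nsmul_mem hφ l) (I.nsmul_mem hψ k), ?_⟩
    rw [map_add, map_nsmul, map_nsmul, ← hf, ← hg, nsmul_eq_mul, nsmul_eq_mul, mul_add,
      ← mul_assoc, ← mul_assoc, ← Nat.cast_mul, ← Nat.cast_mul, mul_comm l k]

theorem IsRightIdeal.fractionSubgroup {E R : Type*} [Ring E] [Ring R] {j : E →+* R}
    {I : AddSubgroup E} (hI : IsRightIdeal I)
    (hfrac : ∀ f : R, ∃ k : ℕ, k ≠ 0 ∧ ∃ φ, (k : R) * f = j φ) :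
    IsRightIdeal (fractionSubgroup j I) := by
  rintro f ⟨k, hk, φ, hφ, hf⟩ g
  obtain ⟨l, hl, ψ, hg⟩ := hfrac g
  refine ⟨k * l, mul_ne_zero hk hl, φ * ψ, hI φ hφ ψ, ?_⟩
  rw [map_mul, ← hf, ← hg, Nat.cast_mul, mul_assoc, mul_assoc, ← mul_assoc (l : R),
    (Nat.cast_commute l f).eq, mul_assoc]

section Fractions

variable {E R : Type*} [Ring E] [Ring R] [Algebra ℚ R] {j : E →+* R}

theorem natCast_mul_cancel {k : ℕ} (hk : k ≠ 0) {f g : R} (h : (k : R) * f = k * g) : f = g := by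
  have h' := congrArg (fun r => ((k : ℚ)⁻¹) • r) h
  have hk' : (k : ℚ) ≠ 0 := Nat.cast_ne_zero.2 hk
  simpa only [← nsmul_eq_mul, ← Nat.cast_smul_eq_nsmul ℚ, smul_smul, inv_mul_cancel₀ hk',
    one_smul] using h'

theorem map_mem_center_of_mem_center (hfrac : ∀ f : R, ∃ k : ℕ, k ≠ 0 ∧ ∃ φ, (k : R) * f = j φ)
    {x : E} (hx : x ∈ Subring.center E) : j x ∈ Subring.center R := by
  rw [Subring.mem_center_iff] at hx ⊢
  intro f
  obtain ⟨k, hk, φ, hφ⟩ := hfrac f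
  refine natCast_mul_cancel hk ?_
  rw [← mul_assoc, hφ, ← mul_assoc, (Nat.cast_commute k (j x)).eq, mul_assoc, hφ, ← map_mul,
    ← map_mul, hx]

theorem IsCentrallyEssential.of_fractions (hE : IsCentrallyEssential E) (hj : Function.Injective j)
    (hfrac : ∀ f : R, ∃ k : ℕ, k ≠ 0 ∧ ∃ φ, (k : R) * f = j φ) : IsCentrallyEssential R := by
  intro f hf
  obtain ⟨k, hk, φ, hφ⟩ := hfrac f
  have hφ0 : φ ≠ 0 := by
    rintro rfl
    exact hf (natCast_mul_cancel hk (by rw [hφ, map_zero, mul_zero]))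
  obtain ⟨x, y, hx, hy, hx0, hy0, hxy⟩ := hE φ hφ0
  refine ⟨k * j x, j y, mul_mem (natCast_mem _ k) (map_mem_center_of_mem_center hfrac hx),
    map_mem_center_of_mem_center hfrac hy, fun h => hx0 (hj ?_),
    (map_ne_zero_iff j hj).2 hy0, ?_⟩
  · rw [map_zero]
    exact natCast_mul_cancel hk (by rw [h, mul_zero])
  · rw [← hxy, map_mul, ← hφ, ← mul_assoc, (Nat.cast_commute k f).eq]

/-- Writing `x = s + n` with `s` central and `n` nilpotent, a suitable `m` makes all denominators in
the binomial expansion of `s ^ m = (x - n) ^ m` cancel modulo `N`. -/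
theorem IsCentrallyEssential.exists_pow_eq_add [FiniteDimensional ℚ R]
    (hE : IsCentrallyEssential E) (hj : Function.Injective j)
    (hfrac : ∀ f : R, ∃ k : ℕ, k ≠ 0 ∧ ∃ φ, (k : R) * f = j φ) {N : ℕ} (hN : N ≠ 0) (x : E) :
    ∃ m : ℕ, m ≠ 0 ∧ ∃ c ∈ Subring.center E, ∃ e, x ^ m = c + N * e := by
  obtain ⟨s, hs, n, ⟨d, hd⟩, hx⟩ :=
    (hE.of_fractions hj hfrac).exists_eq_add_isNilpotent ℚ (j x)
  obtain ⟨k, hk, ν, hν⟩ := hfrac n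
  set m := N * (k ^ d * d.factorial) with hm
  have hm0 : m ≠ 0 := mul_ne_zero hN (mul_ne_zero (pow_ne_zero _ hk) d.factorial_ne_zero)
  have hterm (i : ℕ) : ∃ e : E, (-n) ^ (i + 1) * (m.choose (i + 1) : R) = j (N * e) := by
    by_cases hi : d ≤ i + 1
    · refine ⟨0, ?_⟩
      rw [neg_pow, pow_eq_zero_of_le hi hd]
      simp
    · push Not at hi
      obtain ⟨t, ht⟩ : N * k ^ d ∣ m.choose (i + 1) := by
        obtain ⟨u, hu⟩ : i + 1 ∣ d.factorial := Nat.dvd_factorial (Nat.add_one_pos i) hi.le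
        refine ⟨u * (m - 1).choose i, ?_⟩
        have h1 : m * (m - 1).choose i = m.choose (i + 1) * (i + 1) := by
          have := Nat.add_one_mul_choose_eq (m - 1) i
          rwa [Nat.sub_add_cancel (Nat.one_le_iff_ne_zero.2 hm0)] at this
        refine Nat.eq_of_mul_eq_mul_right (Nat.add_one_pos i) ?_
        rw [← h1, hm, hu]
        ring
      refine ⟨(k ^ (d - (i + 1)) * t) • ((-1) ^ (i + 1) * ν ^ (i + 1)), ?_⟩
      have hkd : k ^ d = k ^ (d - (i + 1)) * k ^ (i + 1) := by
        rw [← pow_add, Nat.sub_add_cancel hi.le]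
      have hnu : j ν ^ (i + 1) = k ^ (i + 1) • n ^ (i + 1) := by
        rw [← hν, (Nat.cast_commute k n).mul_pow, nsmul_eq_mul, Nat.cast_pow]
      rw [← nsmul_eq_mul', ← nsmul_eq_mul, map_nsmul, map_nsmul, map_mul, map_pow, map_pow, map_neg,
        map_one, hnu, mul_smul_comm, smul_smul, smul_smul, ← neg_pow, ht, hkd]
      congr 1
      ring
  choose e he using hterm
  have hsx : s = -n + j x := by rw [hx]; abel
  have hcomm : Commute (-n) (j x) := by
    have : Commute n s := Subring.mem_center_iff.1 hs n
    rw [hx]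
    exact (this.add_right (Commute.refl n)).neg_left
  set b : E := ∑ i ∈ Finset.range m, e i * x ^ (m - (i + 1)) with hb
  have hsm : s ^ m = j (x ^ m + N * b) := by
    rw [hsx, hcomm.add_pow, Finset.sum_range_succ', hb, Finset.mul_sum, map_add, map_sum, add_comm]
    congr 1
    · simp
    · refine Finset.sum_congr rfl fun i _ => ?_
      rw [mul_assoc, ← (Nat.cast_commute (m.choose (i + 1)) (j x ^ (m - (i + 1)))).eq, ← mul_assoc,
        he, ← mul_assoc, map_mul j (_ * _), map_pow]
  refine ⟨m, hm0, x ^ m + N * b, mem_center_of_map_mem_center hj (hsm ▸ pow_mem hs m), -b, ?_⟩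
  rw [mul_neg]
  abel

end Fractions

/-- The elements of a `ℚ`-algebra with a nonzero multiple in the image of `j`. -/
def rationalClosure {E S : Type*} [Ring E] [Ring S] [Algebra ℚ S] (j : E →+* S) :
    Subalgebra ℚ S where
  carrier := {f | ∃ k : ℕ, k ≠ 0 ∧ ∃ φ, (k : S) * f = j φ}
  mul_mem' := by
    rintro f g ⟨k, hk, φ, hφ⟩ ⟨l, hl, ψ, hψ⟩
    refine ⟨k * l, mul_ne_zero hk hl, φ * ψ, ?_⟩
    rw [map_mul, ← hφ, ← hψ, Nat.cast_mul, mul_assoc, mul_assoc, ← mul_assoc (l : S),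
      (Nat.cast_commute l f).eq, mul_assoc]
  add_mem' := by
    rintro f g ⟨k, hk, φ, hφ⟩ ⟨l, hl, ψ, hψ⟩
    refine ⟨k * l, mul_ne_zero hk hl, l * φ + k * ψ, ?_⟩
    rw [map_add, map_mul, map_mul, ← hφ, ← hψ, map_natCast, map_natCast, mul_add, ← mul_assoc,
      ← mul_assoc, ← Nat.cast_mul, ← Nat.cast_mul, mul_comm l k]
  algebraMap_mem' q := by
    refine ⟨q.den, q.den_ne_zero, (q.num : E), ?_⟩
    rw [map_intCast, ← map_natCast (algebraMap ℚ S), ← map_mul, Rat.den_mul_eq_num,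
      map_intCast]

/-- The corestriction of `j` to `rationalClosure j`. -/
def toRationalClosure {E S : Type*} [Ring E] [Ring S] [Algebra ℚ S] (j : E →+* S) :
    E →+* rationalClosure j :=
  j.codRestrict (rationalClosure j) fun φ => ⟨1, one_ne_zero, φ, by rw [Nat.cast_one, one_mul]⟩

theorem toRationalClosure_injective {E S : Type*} [Ring E] [Ring S] [Algebra ℚ S] {j : E →+* S}
    (hj : Function.Injective j) : Function.Injective (toRationalClosure j) :=
  fun _ _ h => hj (congrArg Subtype.val h)

theorem exists_natCast_mul_eq_toRationalClosure {E S : Type*} [Ring E] [Ring S] [Algebra ℚ S]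
    (j : E →+* S) (f : rationalClosure j) :
    ∃ k : ℕ, k ≠ 0 ∧ ∃ φ, (k : rationalClosure j) * f = toRationalClosure j φ := by
  obtain ⟨k, hk, φ, hφ⟩ := f.2
  exact ⟨k, hk, φ, Subtype.ext hφ⟩

theorem mk_one_injective_of_torsionFree {A : Type*} [AddCommGroup A]
    (htf : ∀ (n : ℤ) (a : A), n ≠ 0 → n • a = 0 → a = 0) :
    Function.Injective (TensorProduct.mk ℤ ℚ A 1) := by
  rw [← LinearMap.ker_eq_bot, LinearMap.ker_eq_bot']
  intro a ha
  obtain ⟨n, hn⟩ := (IsLocalizedModule.eq_zero_iff (nonZeroDivisors ℤ) _).1 ha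
  exact htf n a (nonZeroDivisors.coe_ne_zero n) hn

theorem finite_of_surjective_of_forall_nsmul_eq_zero {A Q : Type*} [AddCommGroup A]
    [AddCommGroup Q] (htf : ∀ (n : ℤ) (a : A), n ≠ 0 → n • a = 0 → a = 0)
    [FiniteDimensional ℚ (ℚ ⊗[ℤ] A)] {N : ℕ} (hN : N ≠ 0) (π : A →+ Q)
    (hπ : Function.Surjective π) (hQ : ∀ q : Q, N • q = 0) : Finite Q := by
  classical
  by_contra hinf
  rw [not_finite_iff_infinite] at hinf
  obtain ⟨t, ht⟩ := Infinite.exists_subset_card_eq Q (N ^ Module.finrank ℚ (ℚ ⊗[ℤ] A) + 1)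
  choose σ hσ using hπ
  let B : Submodule ℤ A := Submodule.span ℤ (t.image σ : Finset A)
  have : Module.Finite ℤ B := Module.Finite.span_finset ℤ _
  have hA : Module.IsTorsionFree ℤ A :=
    .of_smul_eq_zero fun n a h => or_iff_not_imp_left.2 fun hn => htf n a hn h
  let b := Module.finBasis ℤ B
  have hrank : Module.finrank ℤ B ≤ Module.finrank ℚ (ℚ ⊗[ℤ] A) := by
    let f : B →ₗ[ℤ] ℚ ⊗[ℤ] A := TensorProduct.mk ℤ ℚ A 1 ∘ₗ B.subtype
    have hf : Function.Injective f :=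
      (mk_one_injective_of_torsionFree htf).comp Subtype.val_injective
    have h := f.rank_le_of_injective hf
    rw [← IsFractionRing.rank_right_eq ℤ ℚ (ℚ ⊗[ℤ] A), ← Module.finrank_eq_rank,
      ← Module.finrank_eq_rank] at h
    exact_mod_cast h
  let g : (Fin (Module.finrank ℤ B) → Fin N) → Q := fun c => ∑ i, (c i : ℕ) • π (b i)
  have hsub : t ⊆ Finset.univ.image g := by
    intro q hq
    have hqB : σ q ∈ B := Submodule.subset_span (Finset.mem_coe.2 (Finset.mem_image_of_mem σ hq))
    have hNz : (N : ℤ) ≠ 0 := by exact_mod_cast hN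
    refine Finset.mem_image.2 ⟨fun i => ⟨(b.repr ⟨σ q, hqB⟩ i % N).toNat, ?_⟩, Finset.mem_univ _, ?_⟩
    · have h1 := Int.emod_nonneg (b.repr ⟨σ q, hqB⟩ i) hNz
      have h2 := Int.emod_lt_of_pos (b.repr ⟨σ q, hqB⟩ i) (by lia : (0 : ℤ) < N)
      lia
    · have hsum := congrArg (fun y : B => π (y : A)) (b.sum_repr ⟨σ q, hqB⟩)
      simp only [AddSubmonoidClass.coe_finsetSum, map_sum, hσ] at hsum
      refine Eq.trans ?_ hsum
      refine Finset.sum_congr rfl fun i _ => ?_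
      rw [← natCast_zsmul, Int.toNat_of_nonneg (Int.emod_nonneg _ hNz), Int.emod_def, sub_smul,
        mul_smul, natCast_zsmul, hQ, sub_zero, Submodule.coe_smul, map_zsmul]
  have hcard := (Finset.card_le_card hsub).trans Finset.card_image_le
  rw [ht, Finset.card_univ, Fintype.card_fun, Fintype.card_fin, Fintype.card_fin] at hcard
  have := Nat.pow_le_pow_right (Nat.pos_of_ne_zero hN) hrank
  lia

/-- The action of the endomorphisms of `A` on its rational hull. -/
noncomputable def endToRational (A : Type*) [AddCommGroup A] :
    AddMonoid.End A →+* Module.End ℚ (ℚ ⊗[ℤ] A) :=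
  (Module.End.baseChangeHom ℤ ℚ A : Module.End ℤ A →+* Module.End ℚ (ℚ ⊗[ℤ] A)).comp
    (addMonoidEndRingEquivInt A : AddMonoid.End A →+* Module.End ℤ A)

theorem endToRational_tmul {A : Type*} [AddCommGroup A] (φ : AddMonoid.End A) (q : ℚ) (a : A) :
    endToRational A φ (q ⊗ₜ a) = q ⊗ₜ φ a := rfl

theorem endToRational_injective {A : Type*} [AddCommGroup A]
    (htf : ∀ (n : ℤ) (a : A), n ≠ 0 → n • a = 0 → a = 0) :
    Function.Injective (endToRational A) := by
  intro φ ψ h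
  ext a
  apply mk_one_injective_of_torsionFree htf
  exact LinearMap.congr_fun h (1 ⊗ₜ a)

theorem Module.Finite.center_of_algebra {K R V : Type*} [Field K] [Ring R] [Algebra K R]
    [AddCommGroup V] [Module K V] [Module R V] [IsScalarTower K R V] [FiniteDimensional K V] :
    Module.Finite (Subring.center R) V := by
  obtain ⟨t, ht⟩ := Module.Finite.fg_top (R := K) (M := V)
  refine ⟨⟨t, eq_top_iff.2 fun v _ => ?_⟩⟩
  have hv : v ∈ Submodule.span K (t : Set V) := ht ▸ Submodule.mem_top
  induction hv using Submodule.span_induction with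
  | mem x hx => exact Submodule.subset_span hx
  | zero => exact zero_mem _
  | add x y _ _ hx hy => exact add_mem (hx trivial) (hy trivial)
  | smul c x _ hx =>
    have hc : algebraMap K R c ∈ Subring.center R :=
      Subring.mem_center_iff.2 fun r => (Algebra.commutes c r).symm
    have h := Submodule.smul_mem _ (⟨_, hc⟩ : Subring.center R) (hx trivial)
    rwa [Subring.smul_def, algebraMap_smul] at h

theorem exists_natCast_mem {A : Type*} [AddCommGroup A]
    (htf : ∀ (n : ℤ) (a : A), n ≠ 0 → n • a = 0 → a = 0)
    [FiniteDimensional ℚ (ℚ ⊗[ℤ] A)] (hce : IsCentrallyEssential (AddMonoid.End A))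
    {I : AddSubgroup (AddMonoid.End A)} (hI : IsRightIdeal I)
    (hIA : AddSubgroup.closure {x : A | ∃ φ ∈ I, ∃ a : A, x = φ a} = ⊤) :
    ∃ N : ℕ, N ≠ 0 ∧ (N : AddMonoid.End A) ∈ I := by
  set j := toRationalClosure (endToRational A) with hjdef
  have hj : Function.Injective j := toRationalClosure_injective (endToRational_injective htf)
  have hfrac := exists_natCast_mul_eq_toRationalClosure (endToRational A)
  have := Module.Finite.center_of_algebra (K := ℚ) (R := rationalClosure (endToRational A))
    (V := ℚ ⊗[ℤ] A)
  have : Module.Finite (rationalClosure (endToRational A)) (ℚ ⊗[ℤ] A) :=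
    Module.Finite.of_restrictScalars_finite ℚ _ _
  set L := fractionSubgroup (R := rationalClosure (endToRational A)) j I
  have hL : IsRightIdeal L := hI.fractionSubgroup hfrac
  have hLV : AddSubgroup.closure {v : ℚ ⊗[ℤ] A | ∃ f ∈ L, ∃ u : ℚ ⊗[ℤ] A, v = f • u} = ⊤ := by
    refine eq_top_iff.2 fun v _ => ?_
    induction v using TensorProduct.induction_on with
    | zero => exact zero_mem _
    | add v w hv hw => exact add_mem (hv trivial) (hw trivial)
    | tmul q a =>
      have ha : a ∈ AddSubgroup.closure {x : A | ∃ φ ∈ I, ∃ a : A, x = φ a} :=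
        hIA ▸ AddSubgroup.mem_top a
      induction ha using AddSubgroup.closure_induction with
      | mem a ha =>
        obtain ⟨φ, hφ, b, rfl⟩ := ha
        refine AddSubgroup.subset_closure ⟨j φ, ⟨1, one_ne_zero, φ, hφ, ?_⟩, q ⊗ₜ b, rfl⟩
        rw [Nat.cast_one, one_mul]
      | zero => rw [TensorProduct.tmul_zero]; exact zero_mem _
      | add a b _ _ ha hb => rw [TensorProduct.tmul_add]; exact add_mem (ha trivial) (hb trivial)
      | neg a _ ha => rw [TensorProduct.tmul_neg]; exact neg_mem (ha trivial)
  obtain ⟨c, ⟨k, hk, φ, hφ, hc⟩, hcv⟩ := exists_mem_forall_smul_eq_self hL hLV fun f hf => by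
    obtain ⟨s, hs, n, hn, hsn⟩ :=
      (hce.of_fractions hj hfrac).exists_eq_add_isNilpotent ℚ f
    obtain ⟨m, c, hc, ⟨r, hr⟩, e, he⟩ := exists_pow_eq_mul_of_isNilpotent hs hn hsn
    exact ⟨m, c, hc, hr ▸ hL f hf r, e, fun v => by rw [he, mul_smul]⟩
  have hc1 : c = 1 := Subtype.ext (LinearMap.ext hcv)
  refine ⟨k, hk, ?_⟩
  have hφk : φ = k := hj (by rw [← hc, hc1, mul_one, map_natCast])
  exact hφk ▸ hφ

theorem eq_top_of_natCast_mem {A : Type*} [AddCommGroup A]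
    (htf : ∀ (n : ℤ) (a : A), n ≠ 0 → n • a = 0 → a = 0)
    [FiniteDimensional ℚ (ℚ ⊗[ℤ] A)] (hce : IsCentrallyEssential (AddMonoid.End A))
    {I : AddSubgroup (AddMonoid.End A)} (hI : IsRightIdeal I)
    (hIA : AddSubgroup.closure {x : A | ∃ φ ∈ I, ∃ a : A, x = φ a} = ⊤)
    {N : ℕ} (hN : N ≠ 0) (hNI : (N : AddMonoid.End A) ∈ I) : I = ⊤ := by
  let W : Submodule (AddMonoid.End A) A :=
    { (nsmulAddMonoidHom N : A →+ A).range.toAddSubmonoid with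
      smul_mem' := by
        rintro φ _ ⟨a, rfl⟩
        exact ⟨φ a, (map_nsmul φ N a).symm⟩ }
  have hW (a : A) : a ∈ W ↔ ∃ b, N • b = a := Iff.rfl
  have : Finite (A ⧸ W) := by
    refine finite_of_surjective_of_forall_nsmul_eq_zero htf hN W.mkQ.toAddMonoidHom W.mkQ_surjective
      fun q => ?_
    obtain ⟨a, rfl⟩ := W.mkQ_surjective q
    rw [← map_nsmul]
    exact (Submodule.Quotient.mk_eq_zero W).2 ⟨a, rfl⟩
  have hV : AddSubgroup.closure {v : A ⧸ W | ∃ φ ∈ I, ∃ u : A ⧸ W, v = φ • u} = ⊤ := by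
    refine eq_top_iff.2 fun v _ => ?_
    obtain ⟨a, rfl⟩ := W.mkQ_surjective v
    have ha : a ∈ AddSubgroup.closure {x : A | ∃ φ ∈ I, ∃ a : A, x = φ a} :=
      hIA ▸ AddSubgroup.mem_top a
    induction ha using AddSubgroup.closure_induction with
    | mem a ha =>
      obtain ⟨φ, hφ, b, rfl⟩ := ha
      exact AddSubgroup.subset_closure ⟨φ, hφ, W.mkQ b, rfl⟩
    | zero => rw [map_zero]; exact zero_mem _
    | add a b _ _ ha hb => rw [map_add]; exact add_mem (ha trivial) (hb trivial)
    | neg a _ ha => rw [map_neg]; exact neg_mem (ha trivial)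
  have hNV (v : A ⧸ W) : (N : AddMonoid.End A) • v = 0 := by
    obtain ⟨a, rfl⟩ := W.mkQ_surjective v
    exact (Submodule.Quotient.mk_eq_zero W).2 ⟨a, rfl⟩
  obtain ⟨c, hcI, hc⟩ := exists_mem_forall_smul_eq_self hI hV fun x hx => by
    obtain ⟨m, hm, c, hc, e, he⟩ := hce.exists_pow_eq_add
      (toRationalClosure_injective (endToRational_injective htf))
      (exists_natCast_mul_eq_toRationalClosure (endToRational A)) hN x
    refine ⟨m, c, hc, ?_, 1, fun v => ?_⟩
    · have hxm : x ^ m ∈ I := by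
        obtain ⟨l, rfl⟩ := Nat.exists_eq_succ_of_ne_zero hm
        rw [pow_succ']
        exact hI x hx _
      rw [eq_sub_of_add_eq he.symm]
      exact I.sub_mem hxm (hI _ hNI e)
    · rw [he, add_smul, mul_smul, hNV, add_zero, one_smul]
  have hdiv (a : A) : ∃ b, N • b = a - c a := by
    rw [← hW, ← Submodule.Quotient.mk_eq_zero, Submodule.Quotient.mk_sub, sub_eq_zero]
    exact (hc (W.mkQ a)).symm
  choose g hg using hdiv
  have hcancel {a b : A} (h : N • a = N • b) : a = b := by
    refine sub_eq_zero.1 (htf N _ (Nat.cast_ne_zero.2 hN) ?_)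
    rw [natCast_zsmul, smul_sub, h, sub_self]
  let e : AddMonoid.End A := AddMonoidHom.mk' g fun a b => hcancel (by
    rw [smul_add, hg, hg, hg, map_add]
    abel)
  have h1 : (1 : AddMonoid.End A) = c + N * e := by
    ext a
    change a = c a + N • g a
    rw [hg, add_sub_cancel]
  have h1I : (1 : AddMonoid.End A) ∈ I := h1 ▸ I.add_mem hcI (hI _ hNI e)
  exact eq_top_iff.2 fun x _ => one_mul x ▸ hI 1 h1I x

/-- Theorem 1.4: a torsion-free abelian group `A` of finite rank whose endomorphism
ring is centrally essential is faithful: for every proper right ideal `I` of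
`End A`, the subgroup `I·A` generated by all `φ a` (`φ ∈ I`, `a ∈ A`) is a proper
subgroup of `A`. -/
theorem centrallyEssential_end_implies_faithful
    (A : Type*) [AddCommGroup A]
    (htf : ∀ (n : ℤ) (a : A), n ≠ 0 → n • a = 0 → a = 0)
    (hfr : FiniteDimensional ℚ (ℚ ⊗[ℤ] A))
    (hce : IsCentrallyEssential (AddMonoid.End A)) :
    ∀ I : AddSubgroup (AddMonoid.End A), IsRightIdeal I → I ≠ ⊤ →
      AddSubgroup.closure {x : A | ∃ φ ∈ I, ∃ a : A, x = φ a} ≠ ⊤ := by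
  intro I hI hne hIA
  obtain ⟨N, hN, hNI⟩ := exists_natCast_mem htf hce hI hIA
  exact hne (eq_top_of_natCast_mem htf hce hI hIA hN hNI)
end

section
/- Let R be a centrally essential torsion-free ring of finite rank. Then for all a, b ∈ R, the commutator a·b − b·a lies in every maximal right ideal of R (equivalently, a·b − b·a belongs to the Jacobson radical of R, so R modulo its Jacobson radical is commutative). -/
open TensorProduct

/-- A maximal right ideal: a proper right ideal maximal among proper right ideals. -/
def IsMaximalRightIdeal {R : Type*} [Ring R] (M : AddSubgroup R) : Prop :=
  IsRightIdeal M ∧ M ≠ ⊤ ∧ ∀ I : AddSubgroup R, IsRightIdeal I → M < I → I = ⊤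

/-- Idempotents of a centrally essential ring are central. -/
theorem IsCentrallyEssential.mul_comm_of_isIdempotentElem {A : Type*} [Ring A]
    (hA : IsCentrallyEssential A) {e : A} (he : IsIdempotentElem e) (a : A) :
    e * a = a * e := by
  have he' : e * e = e := he
  have h₁ : e * a * (1 - e) = 0 := by
    by_contra h
    obtain ⟨x, y, hx, hy, -, hy0, hxy⟩ := hA _ h
    rw [Subring.mem_center_iff] at hx hy
    apply hy0
    have hey : e * y = y := by
      rw [← hxy]
      simp only [← mul_assoc, he']
    rw [← hey, hy e, ← hxy, mul_assoc, ← hx e, ← mul_assoc, mul_assoc (e * a), sub_mul, he',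
      one_mul, sub_self, mul_zero, zero_mul]
  have h₂ : (1 - e) * a * e = 0 := by
    by_contra h
    obtain ⟨x, y, hx, hy, -, hy0, hxy⟩ := hA _ h
    rw [Subring.mem_center_iff] at hx hy
    apply hy0
    have hye : y * e = y := by
      rw [← hxy, mul_assoc, ← hx e, ← mul_assoc, mul_assoc ((1 - e) * a), he']
    rw [← hye, ← hy e, ← hxy]
    simp only [← mul_assoc, mul_sub, he', mul_one, sub_self, zero_mul]
  rw [mul_sub, mul_one, sub_eq_zero] at h₁
  rw [sub_mul, sub_mul, one_mul, sub_eq_zero] at h₂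
  rw [h₁, h₂]

/-- In a finite-dimensional centrally essential algebra, every nonzero idempotent `e` has a nonzero
multiple annihilating all commutators. -/
theorem IsCentrallyEssential.exists_mul_commutator_eq_zero (K : Type*) {A : Type*} [Field K]
    [Ring A] [Algebra K A] [FiniteDimensional K A] (hA : IsCentrallyEssential A) {e : A}
    (he : IsIdempotentElem e) (he0 : e ≠ 0) :
    ∃ y : A, y ≠ 0 ∧ y * e = y ∧ ∀ a b : A, y * (a * b - b * a) = 0 := by
  let S : Set (Submodule K A) := {N | ∃ y : A, y ∈ Subring.center A ∧ y ≠ 0 ∧ y * e = y ∧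
    N = LinearMap.ker (LinearMap.mulLeft K y)}
  have hS : S.Nonempty :=
    ⟨_, e, Subring.mem_center_iff.2 fun a => (hA.mul_comm_of_isIdempotentElem he a).symm,
      he0, he, rfl⟩
  obtain ⟨N, ⟨y, hyc, hy0, hye, rfl⟩, hmax⟩ :=
    set_has_maximal_iff_noetherian.2 (inferInstance : IsNoetherian K A) S hS
  refine ⟨y, hy0, hye, fun a b => ?_⟩
  by_cases hya : y * a = 0
  · rw [mul_sub, ← mul_assoc, hya, ← mul_assoc, ← Subring.mem_center_iff.1 hyc b, mul_assoc, hya]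
    simp
  obtain ⟨x, z, hx, hz, -, hz0, hxz⟩ := hA _ hya
  have hyx : y * x ∈ Subring.center A := mul_mem hyc hx
  have hxc := Subring.mem_center_iff.1 hx
  have hyc' := Subring.mem_center_iff.1 hyc
  have hz' : y * x * a = z := by rw [mul_assoc, ← hxc, ← mul_assoc, hxz]
  have hyx0 : y * x ≠ 0 := by
    intro h
    rw [h, zero_mul] at hz'
    exact hz0 hz'.symm
  have hle : LinearMap.ker (LinearMap.mulLeft K y) ≤
      LinearMap.ker (LinearMap.mulLeft K (y * x)) := by
    intro t ht
    simp only [LinearMap.mem_ker, LinearMap.mulLeft_apply] at ht ⊢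
    rw [mul_assoc, ← hxc, ← mul_assoc, ht, zero_mul]
  have hyxe : y * x * e = y * x := by rw [mul_assoc, ← hxc, ← mul_assoc, hye]
  have hnot := hmax _ ⟨y * x, hyx, hyx0, hyxe, rfl⟩
  have hmem : a * b - b * a ∈ LinearMap.ker (LinearMap.mulLeft K (y * x)) := by
    rw [LinearMap.mem_ker, LinearMap.mulLeft_apply, mul_sub, ← mul_assoc, hz', ← mul_assoc,
      ← Subring.mem_center_iff.1 hyx b, mul_assoc, hz', Subring.mem_center_iff.1 hz b, sub_self]
  have heq := hle.eq_of_not_lt hnot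
  rw [← heq] at hmem
  simpa using hmem

/-- An element of a finite-dimensional algebra is nilpotent or has a nonzero idempotent
right multiple. -/
theorem isNilpotent_or_exists_isIdempotentElem_mul (K : Type*) {A : Type*} [Field K] [Ring A]
    [Algebra K A] [FiniteDimensional K A] (w : A) :
    IsNilpotent w ∨ ∃ d : A, IsIdempotentElem (w * d) ∧ w * d ≠ 0 := by
  let B := Algebra.adjoin K {w}
  have : IsMulCommutative B := Algebra.isMulCommutative_adjoin K (by simp)
  have : IsArtinianRing B := IsArtinianRing.of_finite K B
  let v : B := ⟨w, Algebra.self_mem_adjoin_singleton K w⟩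
  obtain ⟨n, d, hd⟩ := IsArtinian.exists_pow_succ_smul_dvd v (1 : B)
  simp only [smul_eq_mul, mul_one, Nat.succ_eq_add_one] at hd
  have hpow : ∀ k : ℕ, v ^ (n + k) * d ^ k = v ^ n := by
    intro k
    induction k with
    | zero => simp
    | succ k ih =>
      calc v ^ (n + (k + 1)) * d ^ (k + 1) = (v ^ (n + 1) * d) * (v ^ k * d ^ k) := by ring
        _ = v ^ (n + k) * d ^ k := by rw [hd]; ring
        _ = v ^ n := ih
  by_cases hw : IsNilpotent w
  · exact Or.inl hw
  refine Or.inr ⟨((v ^ n * d ^ (n + 1) : B) : A), ?_, ?_⟩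
  · have h : IsIdempotentElem (v * (v ^ n * d ^ (n + 1))) := by
      calc v * (v ^ n * d ^ (n + 1)) * (v * (v ^ n * d ^ (n + 1)))
          = v * (v ^ (n + (n + 1)) * d ^ (n + 1)) * d ^ (n + 1) := by ring
        _ = v * (v ^ n * d ^ (n + 1)) := by rw [hpow]; ring
    exact congrArg Subtype.val h
  · intro h
    have h' : v * (v ^ n * d ^ (n + 1)) = 0 := Subtype.ext h
    have hvn : v ^ n = 0 := by
      calc v ^ n = v ^ (n + (n + 1)) * d ^ (n + 1) := (hpow _).symm
        _ = v ^ n * (v * (v ^ n * d ^ (n + 1))) := by ring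
        _ = 0 := by rw [h', mul_zero]
    exact hw ⟨n, congrArg Subtype.val hvn⟩

/-- Right multiples of commutators in a finite-dimensional centrally essential algebra are
nilpotent. -/
theorem IsCentrallyEssential.isNilpotent_commutator_mul (K : Type*) {A : Type*} [Field K] [Ring A]
    [Algebra K A] [FiniteDimensional K A] (hA : IsCentrallyEssential A) (a b r : A) :
    IsNilpotent ((a * b - b * a) * r) := by
  refine (isNilpotent_or_exists_isIdempotentElem_mul K _).resolve_right ?_
  rintro ⟨d, hd, hd0⟩
  obtain ⟨y, hy0, hye, hy⟩ := hA.exists_mul_commutator_eq_zero K hd hd0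
  apply hy0
  rw [← hye, ← mul_assoc, ← mul_assoc, hy, zero_mul, zero_mul]

/-- Every element of `ℚ ⊗[ℤ] R` has a nonzero integer multiple coming from `R`. -/
theorem exists_int_smul_eq_one_tmul {R : Type*} [Ring R] (t : ℚ ⊗[ℤ] R) :
    ∃ (k : ℤ) (r : R), k ≠ 0 ∧ k • t = 1 ⊗ₜ[ℤ] r := by
  induction t with
  | zero => exact ⟨1, 0, one_ne_zero, by simp⟩
  | tmul q r =>
    refine ⟨q.den, q.num • r, by exact_mod_cast q.den_ne_zero, ?_⟩
    rw [TensorProduct.smul_tmul', ← TensorProduct.smul_tmul]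
    congr 1
    simp [Rat.den_mul_eq_num]
  | add s t hs ht =>
    obtain ⟨k, r, hk, hkr⟩ := hs
    obtain ⟨l, u, hl, hlu⟩ := ht
    refine ⟨k * l, l • r + k • u, mul_ne_zero hk hl, ?_⟩
    rw [TensorProduct.tmul_add, TensorProduct.tmul_smul, TensorProduct.tmul_smul, ← hkr, ← hlu,
      smul_add, smul_smul, smul_smul, mul_comm l k]

/-- A torsion-free ring embeds in its rationalization. -/
theorem one_tmul_rat_injective {R : Type*} [Ring R]
    (htf : ∀ (n : ℤ) (r : R), n ≠ 0 → n • r = 0 → r = 0) :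
    Function.Injective (Algebra.TensorProduct.includeRight : R →ₐ[ℤ] ℚ ⊗[ℤ] R) := by
  have : Module.IsTorsionFree ℤ R := Module.IsTorsionFree.of_smul_eq_zero fun n r h =>
    or_iff_not_imp_left.2 fun hn => htf n r hn h
  exact Algebra.TensorProduct.includeRight_injective (algebraMap ℤ ℚ).injective_int

/-- The rationalization of a torsion-free centrally essential ring is centrally essential. -/
theorem IsCentrallyEssential.rat_tensorProduct {R : Type*} [Ring R]
    (htf : ∀ (n : ℤ) (r : R), n ≠ 0 → n • r = 0 → r = 0) (hce : IsCentrallyEssential R) :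
    IsCentrallyEssential (ℚ ⊗[ℤ] R) := by
  have hinj := one_tmul_rat_injective htf
  have hcenter : ∀ x ∈ Subring.center R, (1 : ℚ) ⊗ₜ[ℤ] x ∈ Subring.center (ℚ ⊗[ℤ] R) := by
    intro x hx
    rw [Subring.mem_center_iff]
    intro t
    induction t with
    | zero => simp
    | tmul q r => simp [Algebra.TensorProduct.tmul_mul_tmul, Subring.mem_center_iff.1 hx r]
    | add s t hs ht => rw [add_mul, mul_add, hs, ht]
  have hne : ∀ x : R, x ≠ 0 → (1 : ℚ) ⊗ₜ[ℤ] x ≠ 0 := fun x hx h =>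
    hx (hinj (by simpa using h))
  intro t ht
  obtain ⟨k, r, hk, hkr⟩ := exists_int_smul_eq_one_tmul t
  have hr : r ≠ 0 := by
    rintro rfl
    have h : (k : ℚ) • t = 0 := by rw [Int.cast_smul_eq_zsmul, hkr, TensorProduct.tmul_zero]
    exact (smul_ne_zero (Int.cast_ne_zero.2 hk) ht) h
  obtain ⟨x, y, hx, hy, hx0, hy0, hxy⟩ := hce r hr
  refine ⟨1 ⊗ₜ (k • x), 1 ⊗ₜ y, hcenter _ (zsmul_mem hx k), hcenter y hy,
    hne _ fun h => hx0 (htf k x hk h), hne y hy0, ?_⟩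
  rw [TensorProduct.tmul_smul, mul_smul_comm, ← smul_mul_assoc, hkr,
    Algebra.TensorProduct.tmul_mul_tmul, one_mul, hxy]

/-- A maximal right ideal contains every element all of whose right multiples are nilpotent. -/
theorem IsMaximalRightIdeal.mem_of_isNilpotent_mul {R : Type*} [Ring R] {M : AddSubgroup R}
    (hM : IsMaximalRightIdeal M) {c : R} (hc : ∀ r, IsNilpotent (c * r)) : c ∈ M := by
  obtain ⟨hright, hne, hmax⟩ := hM
  by_contra hcM
  have htop : M ⊔ (AddMonoidHom.mulLeft c).range = ⊤ := by
    refine hmax _ ?_ (lt_of_le_of_ne le_sup_left ?_)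
    · intro x hx r
      obtain ⟨m, hm, _, ⟨s, rfl⟩, rfl⟩ := AddSubgroup.mem_sup.1 hx
      rw [add_mul]
      exact AddSubgroup.mem_sup.2 ⟨m * r, hright m hm r, _, ⟨s * r, rfl⟩, by simp [mul_assoc]⟩
    · intro h
      apply hcM
      rw [h]
      exact AddSubgroup.mem_sup_right ⟨1, by simp⟩
  obtain ⟨m, hm, _, ⟨s, rfl⟩, hms⟩ := AddSubgroup.mem_sup.1 (htop ▸ AddSubgroup.mem_top (1 : R))
  have hunit : IsUnit m := by
    rw [eq_sub_of_add_eq hms]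
    exact (hc s).isUnit_one_sub
  obtain ⟨u, rfl⟩ := hunit
  refine hne ((AddSubgroup.eq_top_iff' M).2 fun r => ?_)
  simpa using hright _ hm (↑u⁻¹ * r)

/-- Corollary 3.2: in a centrally essential torsion-free ring of finite rank, every
commutator `a * b - b * a` lies in every maximal right ideal, i.e. in the Jacobson
radical; hence the quotient by the Jacobson radical is commutative. -/
theorem centrallyEssential_tffr_commutator_mem_jacobson
    (R : Type*) [Ring R] [Nontrivial R]
    (htf : ∀ (n : ℤ) (r : R), n ≠ 0 → n • r = 0 → r = 0)
    (hfr : FiniteDimensional ℚ (ℚ ⊗[ℤ] R))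
    (hce : IsCentrallyEssential R) :
    ∀ a b : R, ∀ M : AddSubgroup R, IsMaximalRightIdeal M → a * b - b * a ∈ M := by
  intro a b M hM
  refine hM.mem_of_isNilpotent_mul fun r => ?_
  rw [← IsNilpotent.map_iff (one_tmul_rat_injective htf)]
  simp only [map_mul, map_sub]
  exact (hce.rat_tensorProduct htf).isNilpotent_commutator_mul ℚ _ _ _
end

section
/- For every integer n ≥ 7, there exists a torsion-free abelian group A of rank n such that the endomorphism ring End(A) is centrally essential and not right invariant (i.e., End(A) has a right ideal that is not a two-sided ideal), and A is faithful (for every proper right ideal I of End(A), the subgroup I·A is a proper subgroup of A). -/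
open TensorProduct

/-- An additive subgroup of a ring is a left ideal if it is closed under
left multiplication by arbitrary ring elements. -/
def IsLeftIdeal {R : Type*} [Ring R] (I : AddSubgroup R) : Prop :=
  ∀ x ∈ I, ∀ r : R, r * x ∈ I

/-- The elements of `M` that lie in `S` after localizing at `p`: some multiple by an integer
coprime to `p` belongs to `S`. -/
def AddSubgroup.localAt {M : Type*} [AddCommGroup M] (S : AddSubgroup M) (p : ℕ) :
    AddSubgroup M where
  carrier := {v | ∃ N : ℕ, N.Coprime p ∧ N • v ∈ S}
  zero_mem' := ⟨1, Nat.coprime_one_left p, by simp⟩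
  add_mem' := by
    rintro a b ⟨N, hN, ha⟩ ⟨M, hM, hb⟩
    refine ⟨N * M, hN.mul_left hM, ?_⟩
    rw [smul_add]
    refine S.add_mem ?_ ?_
    · rw [mul_comm, mul_smul]
      exact S.nsmul_mem ha M
    · rw [mul_smul]
      exact S.nsmul_mem hb N
  neg_mem' := by
    rintro a ⟨N, hN, ha⟩
    exact ⟨N, hN, by simpa using S.neg_mem ha⟩

namespace AddSubgroup

variable {M : Type*} [AddCommGroup M] {S : AddSubgroup M}

theorem le_localAt (S : AddSubgroup M) (p : ℕ) : S ≤ S.localAt p :=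
  fun v hv => ⟨1, Nat.coprime_one_left p, by simpa using hv⟩

theorem mem_of_nsmul_mem_localAt {p m : ℕ} {v : M} (hm : m.Coprime p)
    (h : m • v ∈ S.localAt p) : v ∈ S.localAt p := by
  obtain ⟨N, hN, hv⟩ := h
  exact ⟨N * m, hN.mul_left hm, by rwa [mul_smul]⟩

theorem mem_of_forall_mem_localAt {v : M} (h : ∀ p : ℕ, p.Prime → v ∈ S.localAt p) : v ∈ S := by
  have key : ∀ N : ℕ, N • v ∈ S ↔ addOrderOf (v : M ⧸ S) ∣ N := fun N => by
    rw [addOrderOf_dvd_iff_nsmul_eq_zero, ← QuotientAddGroup.mk_nsmul,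
      QuotientAddGroup.eq_zero_iff]
  by_cases h1 : addOrderOf (v : M ⧸ S) = 1
  · simpa using (key 1).2 h1.dvd
  · have hp := Nat.minFac_prime h1
    obtain ⟨N, hN, hv⟩ := h _ hp
    exact absurd ((Nat.minFac_dvd _).trans ((key N).1 hv))
      ((Nat.Prime.coprime_iff_not_dvd hp).1 hN.symm)

end AddSubgroup

section Twist

variable {V : Type*} [Ring V] (R : Subring V) (j : ℕ → V)

/-- The group of all `a : V` whose product with `j p - p` is `p`-locally in `R`,
for every prime `p`. -/
def twist : AddSubgroup V where
  carrier := {a | ∀ p : ℕ, p.Prime → a * (j p - p) ∈ R.toAddSubgroup.localAt p}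
  zero_mem' p _ := by simp
  add_mem' ha hb p hp := by simpa [add_mul] using add_mem (ha p hp) (hb p hp)
  neg_mem' ha p hp := by simpa only [neg_mul] using neg_mem (ha p hp)

variable {R j}

theorem localAt_mul_left {r v : V} {p : ℕ} (hr : r ∈ R) (hv : v ∈ R.toAddSubgroup.localAt p) :
    r * v ∈ R.toAddSubgroup.localAt p := by
  obtain ⟨N, hN, hv⟩ := hv
  exact ⟨N, hN, by rw [← mul_smul_comm]; exact R.mul_mem hr hv⟩

theorem localAt_mul_right {r v : V} {p : ℕ} (hr : r ∈ R) (hv : v ∈ R.toAddSubgroup.localAt p) :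
    v * r ∈ R.toAddSubgroup.localAt p := by
  obtain ⟨N, hN, hv⟩ := hv
  exact ⟨N, hN, by rw [← smul_mul_assoc]; exact R.mul_mem hv hr⟩

theorem mul_mem_twist {r a : V} (hr : r ∈ R) (ha : a ∈ twist R j) : r * a ∈ twist R j :=
  fun p hp => by simpa only [mul_assoc] using localAt_mul_left hr (ha p hp)

theorem mem_twist_of_mem (hj : ∀ p, j p ∈ R) {r : V} (hr : r ∈ R) : r ∈ twist R j :=
  fun p _ => AddSubgroup.le_localAt _ _ (R.mul_mem hr (R.sub_mem (hj p) (natCast_mem R p)))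

/-- Left multiplication by elements of `R` on `twist R j`. -/
def twistLeftMul (R : Subring V) (j : ℕ → V) : R →+* AddMonoid.End (twist R j) where
  toFun r :=
    { toFun := fun a => ⟨r * a, mul_mem_twist r.2 a.2⟩
      map_zero' := by simp
      map_add' := fun a b => by simp [mul_add] }
  map_one' := AddMonoidHom.ext fun a => Subtype.ext (one_mul (a : V))
  map_zero' := AddMonoidHom.ext fun a => Subtype.ext (zero_mul (a : V))
  map_mul' r s := AddMonoidHom.ext fun a => Subtype.ext (mul_assoc (r : V) s a)
  map_add' r s := AddMonoidHom.ext fun a => Subtype.ext (add_mul (r : V) s a)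

@[simp]
theorem coe_twistLeftMul (r : R) (a : twist R j) :
    (twistLeftMul R j r a : V) = r * a := rfl

theorem twistLeftMul_injective (hj : ∀ p, j p ∈ R) :
    Function.Injective (twistLeftMul R j) := by
  intro r s h
  have := congrArg (fun φ : AddMonoid.End (twist R j) =>
    (φ ⟨1, mem_twist_of_mem hj R.one_mem⟩ : V)) h
  simpa using this

/-- No nonzero element of `V` is divisible by infinitely many primes `p`, locally at `p`. -/
def IsPrimeSeparated (R : Subring V) : Prop :=
  ∀ v : V, {p : ℕ | p.Prime ∧ ∃ r ∈ R.toAddSubgroup.localAt p, v = p • r}.Infinite → v = 0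

theorem finite_primes_not_mem_localAt (hfull : ∀ v : V, ∃ N : ℕ, N ≠ 0 ∧ N • v ∈ R) (v : V) :
    {p : ℕ | p.Prime ∧ v ∉ R.toAddSubgroup.localAt p}.Finite := by
  obtain ⟨N, hN, hv⟩ := hfull v
  refine N.divisors.finite_toSet.subset ?_
  rintro p ⟨hp, hvp⟩
  refine Nat.mem_divisors.2 ⟨?_, hN⟩
  by_contra hpN
  exact hvp ⟨N, ((Nat.Prime.coprime_iff_not_dvd hp).2 hpN).symm, hv⟩

variable [Algebra ℚ V]

/-- The inverse of `p - j p`, when `j p` squares to zero. -/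
def twistUnit (j : ℕ → V) (p : ℕ) : V := ((p : ℚ) ^ 2)⁻¹ • (j p + p)

theorem sq_nsmul_twistUnit {p : ℕ} (hp : p.Prime) : p ^ 2 • twistUnit j p = j p + p := by
  have : (p : ℚ) ^ 2 ≠ 0 := pow_ne_zero _ (Nat.cast_ne_zero.2 hp.ne_zero)
  rw [twistUnit, ← Nat.cast_smul_eq_nsmul ℚ, smul_smul, Nat.cast_pow, mul_inv_cancel₀ this,
    one_smul]

theorem twistUnit_mul (hj2 : ∀ p, j p * j p = 0) {p : ℕ} (hp : p.Prime) :
    twistUnit j p * (j p - p) = -1 := by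
  have hne : (p : ℚ) ^ 2 ≠ 0 := pow_ne_zero _ (Nat.cast_ne_zero.2 hp.ne_zero)
  have h : (j p + p) * (j p - p) = ((p : ℚ) ^ 2) • (-1 : V) := by
    rw [add_mul, mul_sub, mul_sub, hj2, (Nat.cast_commute p (j p)).eq, ← Nat.cast_pow,
      Nat.cast_smul_eq_nsmul, nsmul_eq_mul]
    push_cast
    noncomm_ring
  rw [twistUnit, smul_mul_assoc, h, smul_smul, inv_mul_cancel₀ hne, one_smul]

theorem twistUnit_mem (hj : ∀ p, j p ∈ R) (hj2 : ∀ p, j p * j p = 0) {p : ℕ} (hp : p.Prime) :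
    twistUnit j p ∈ twist R j := by
  intro q hq
  by_cases hpq : p = q
  · subst hpq
    rw [twistUnit_mul hj2 hp]
    exact AddSubgroup.le_localAt _ _ (R.neg_mem R.one_mem)
  · refine AddSubgroup.mem_of_nsmul_mem_localAt (m := p ^ 2)
      (Nat.Coprime.pow_left 2 ((Nat.coprime_primes hp hq).2 hpq)) ?_
    rw [← smul_mul_assoc, sq_nsmul_twistUnit hp]
    exact AddSubgroup.le_localAt _ _ (R.mul_mem (R.add_mem (hj p) (natCast_mem R p))
      (R.sub_mem (hj q) (natCast_mem R q)))

theorem mem_of_forall_mul_mem_twist (hj : ∀ p, j p ∈ R) (hj2 : ∀ p, j p * j p = 0) {c : V}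
    (hc : ∀ a ∈ twist R j, c * a ∈ twist R j) : c ∈ R := by
  refine AddSubgroup.mem_of_forall_mem_localAt (S := R.toAddSubgroup) fun p hp => ?_
  have h := hc _ (twistUnit_mem hj hj2 hp) p hp
  rw [mul_assoc, twistUnit_mul hj2 hp, mul_neg_one] at h
  simpa using neg_mem h

theorem end_apply_eq_mul (hj : ∀ p, j p ∈ R) (hj2 : ∀ p, j p * j p = 0)
    (hfull : ∀ v : V, ∃ N : ℕ, N ≠ 0 ∧ N • v ∈ R) (hsep : IsPrimeSeparated R)
    (φ : AddMonoid.End (twist R j)) {b : V} (hb : b ∈ R)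
    (hinf : {p : ℕ | p.Prime ∧ j p = b}.Infinite) :
    (φ ⟨b, mem_twist_of_mem hj hb⟩ : V) = φ ⟨1, mem_twist_of_mem hj R.one_mem⟩ * b := by
  set β : V := Subtype.val (φ ⟨b, mem_twist_of_mem hj hb⟩) with hβ
  set c : V := Subtype.val (φ ⟨1, mem_twist_of_mem hj R.one_mem⟩) with hc
  -- for infinitely many primes, `β * b + p (c * b - β)` is locally divisible by `p ^ 2`
  have hloc : {p : ℕ | p.Prime ∧ c * b - β ∈ R.toAddSubgroup.localAt p ∧
      ∃ r ∈ R.toAddSubgroup.localAt p, β * b + p • (c * b - β) = p ^ 2 • r}.Infinite := by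
    refine (((hinf.sdiff (finite_primes_not_mem_localAt hfull c)).sdiff
      (finite_primes_not_mem_localAt hfull (c * b - β)))).mono ?_
    rintro p ⟨⟨⟨hp, rfl⟩, hcp⟩, hdp⟩
    simp only [Set.mem_ofPred_eq, not_and, not_not] at hcp hdp
    refine ⟨hp, hdp hp, (φ ⟨_, twistUnit_mem hj hj2 hp⟩ : V) * (j p - p) + c,
      add_mem ((φ ⟨_, twistUnit_mem hj hj2 hp⟩).2 p hp) (hcp hp), ?_⟩
    have h : (p ^ 2 • (φ ⟨_, twistUnit_mem hj hj2 hp⟩) : V) = β + p • c := by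
      rw [hβ, hc, ← AddSubgroup.coe_nsmul, ← AddSubgroup.coe_nsmul, ← AddSubgroup.coe_add,
        ← map_nsmul, ← map_nsmul, ← map_add]
      congr 2
      ext
      simpa using sq_nsmul_twistUnit (j := j) hp
    rw [smul_add, ← smul_mul_assoc, h]
    simp only [nsmul_eq_mul, Nat.cast_pow]
    have e1 := (Nat.cast_commute p β).eq
    have e2 := (Nat.cast_commute p c).eq
    rw [add_mul, mul_sub β, mul_sub ((p : V) * c), ← e1, mul_assoc (p : V) c (p : V), ← e2]
    noncomm_ring
  have h0 : β * b = 0 := hsep _ <| hloc.mono <| by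
    rintro p ⟨hp, hd, r, hr, h⟩
    refine ⟨hp, p • r - (c * b - β), sub_mem (nsmul_mem hr p) hd, ?_⟩
    rw [smul_sub, smul_smul, ← sq, ← h, add_sub_cancel_right]
  have h1 : c * b - β = 0 := hsep _ <| hloc.mono <| by
    rintro p ⟨hp, hd, r, hr, h⟩
    refine ⟨hp, r, hr, ?_⟩
    rw [h0, zero_add, sq, mul_smul] at h
    rw [← Nat.cast_smul_eq_nsmul ℚ, ← Nat.cast_smul_eq_nsmul ℚ p (p • r)] at h
    exact smul_right_injective V (Nat.cast_ne_zero.2 hp.ne_zero : (p : ℚ) ≠ 0) h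
  exact (sub_eq_zero.1 h1).symm

/-- If `R` is generated as a group by `1` and the elements occurring infinitely often as `j p`,
every endomorphism of `twist R j` is left multiplication by an element of `R`. -/
theorem twistLeftMul_surjective (hj : ∀ p, j p ∈ R) (hj2 : ∀ p, j p * j p = 0)
    (hfull : ∀ v : V, ∃ N : ℕ, N ≠ 0 ∧ N • v ∈ R) (hsep : IsPrimeSeparated R)
    (hgen : R.toAddSubgroup ≤
      AddSubgroup.closure (insert 1 {b | {p : ℕ | p.Prime ∧ j p = b}.Infinite})) :
    Function.Surjective (twistLeftMul R j) := by
  intro φ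
  set c : V := Subtype.val (φ ⟨1, mem_twist_of_mem hj R.one_mem⟩) with hc
  have hR : ∀ b ∈ R.toAddSubgroup, ∃ h : b ∈ twist R j, (φ ⟨b, h⟩ : V) = c * b := by
    intro b hb
    refine AddSubgroup.closure_induction
      (p := fun b _ => ∃ h : b ∈ twist R j, (φ ⟨b, h⟩ : V) = c * b) ?_ ?_ ?_ ?_ (hgen hb)
    · rintro b (rfl | hb)
      · exact ⟨mem_twist_of_mem hj R.one_mem, by rw [mul_one]⟩
      · obtain ⟨p, hp, rfl⟩ := hb.nonempty
        exact ⟨mem_twist_of_mem hj (hj p), end_apply_eq_mul hj hj2 hfull hsep φ (hj p) hb⟩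
    · exact ⟨zero_mem _, by rw [mul_zero]; exact congrArg Subtype.val (map_zero φ)⟩
    · rintro x y - - ⟨hx, hx'⟩ ⟨hy, hy'⟩
      refine ⟨add_mem hx hy, ?_⟩
      rw [mul_add, ← hx', ← hy', ← AddSubgroup.coe_add, ← map_add]
      rfl
    · rintro x - ⟨hx, hx'⟩
      refine ⟨neg_mem hx, ?_⟩
      rw [mul_neg, ← hx', ← AddSubgroup.coe_neg, ← map_neg]
      rfl
  have hA : ∀ a : twist R j, (φ a : V) = c * a := by
    intro a
    obtain ⟨N, hN, ha⟩ := hfull a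
    obtain ⟨h, h'⟩ := hR _ ha
    have e : (⟨N • (a : V), h⟩ : twist R j) = N • a := rfl
    rw [e, map_nsmul, AddSubgroup.coe_nsmul, mul_smul_comm, ← Nat.cast_smul_eq_nsmul ℚ,
      ← Nat.cast_smul_eq_nsmul ℚ N (c * a)] at h'
    exact smul_right_injective V (Nat.cast_ne_zero.2 hN : (N : ℚ) ≠ 0) h'
  refine ⟨⟨c, mem_of_forall_mul_mem_twist hj hj2 fun a ha => ?_⟩, ?_⟩
  · rw [← hA ⟨a, ha⟩]
    exact (φ ⟨a, ha⟩).2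
  · ext a
    exact (hA a).symm

theorem finrank_tensor_twist (hj : ∀ p, j p ∈ R)
    (hfull : ∀ v : V, ∃ N : ℕ, N ≠ 0 ∧ N • v ∈ R) :
    Module.finrank ℚ (ℚ ⊗[ℤ] twist R j) = Module.finrank ℚ V := by
  have : IsLocalizedModule (nonZeroDivisors ℤ) (twist R j).subtype.toIntLinearMap := by
    refine ⟨?_, ?_, ?_⟩
    · intro m
      have hm : ((m : ℤ) : ℚ) ≠ 0 := Int.cast_ne_zero.2 (nonZeroDivisors.coe_ne_zero m)
      rw [Module.End.isUnit_iff]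
      refine ⟨fun v w h => ?_, fun v => ⟨((m : ℤ) : ℚ)⁻¹ • v, ?_⟩⟩
      · simp only [Module.algebraMap_end_apply, ← Int.cast_smul_eq_zsmul ℚ] at h
        exact smul_right_injective V hm h
      · simp only [Module.algebraMap_end_apply, ← Int.cast_smul_eq_zsmul ℚ, smul_smul,
          mul_inv_cancel₀ hm, one_smul]
    · intro v
      obtain ⟨N, hN, hv⟩ := hfull v
      refine ⟨⟨⟨N • v, mem_twist_of_mem hj hv⟩, ⟨N, by simpa using hN⟩⟩, ?_⟩
      exact natCast_zsmul v N
    · intro a b h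
      exact ⟨1, by rw [Subtype.ext h]⟩
  have h := (isLocalizedModule_iff_isBaseChange (nonZeroDivisors ℤ) ℚ
    (twist R j).subtype.toIntLinearMap).1 this
  exact h.equiv.finrank_eq

end Twist

section Transfer

theorem IsCentrallyEssential.of_ringEquiv {R S : Type*} [Ring R] [Ring S] (e : R ≃+* S)
    (h : IsCentrallyEssential R) : IsCentrallyEssential S := by
  have hcen : ∀ x ∈ Subring.center R, e x ∈ Subring.center S := fun x hx =>
    Subring.mem_center_iff.2 fun s => by
      obtain ⟨r, rfl⟩ := e.surjective s
      rw [← map_mul, ← map_mul, Subring.mem_center_iff.1 hx]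
  intro a ha
  obtain ⟨x, y, hx, hy, hx0, hy0, hxy⟩ := h (e.symm a) (by simpa using ha)
  refine ⟨e x, e y, hcen x hx, hcen y hy, by simpa using hx0, by simpa using hy0, ?_⟩
  rw [← hxy, map_mul, e.apply_symm_apply]

theorem exists_isRightIdeal_not_isLeftIdeal_of_ringEquiv {R S : Type*} [Ring R] [Ring S]
    (e : R ≃+* S) (h : ∃ I : AddSubgroup R, IsRightIdeal I ∧ ¬ IsLeftIdeal I) :
    ∃ I : AddSubgroup S, IsRightIdeal I ∧ ¬ IsLeftIdeal I := by
  obtain ⟨I, hI, hI'⟩ := h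
  refine ⟨I.comap e.symm.toAddMonoidHom, fun x hx r => ?_, fun hl => hI' fun x hx r => ?_⟩
  · simpa using hI _ hx (e.symm r)
  · simpa using hl (e x) (by simpa using hx) (e r)

end Transfer

theorem exists_infinite_primes_fiber {ι : Type*} [Countable ι] [Nonempty ι] :
    ∃ e : ℕ → ι, ∀ i, {p : ℕ | p.Prime ∧ e p = i}.Infinite := by
  obtain ⟨f, hf⟩ := exists_surjective_nat ι
  refine ⟨fun p => f (Nat.unpair (Nat.count Nat.Prime p)).1, fun i => ?_⟩
  obtain ⟨m, rfl⟩ := hf i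
  refine Set.infinite_of_injective_forall_mem
    (f := fun k => Nat.nth Nat.Prime (Nat.pair m k)) ?_ fun k => ⟨?_, ?_⟩
  · intro k l h
    simpa using Nat.nth_injective Nat.infinite_setOfPred_prime h
  · exact Nat.prime_nth_prime _
  · simp only [Nat.count_nth_of_infinite Nat.infinite_setOfPred_prime, Nat.unpair_pair]

theorem Rat.eq_zero_of_infinite_primes {q : ℚ}
    (h : {p : ℕ | p.Prime ∧ ∃ N : ℕ, N.Coprime p ∧ ∃ z : ℤ, N * q = p * z}.Infinite) : q = 0 := by
  by_contra hq
  refine h (q.num.natAbs.divisors.finite_toSet.subset ?_)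
  rintro p ⟨hp, N, hN, z, hz⟩
  refine Nat.mem_divisors.2 ⟨?_, by simpa using hq⟩
  have h1 : (N : ℤ) * q.num = p * (z * q.den) := by
    have : (N : ℚ) * q.num = p * (z * q.den) := by
      rw [← mul_assoc, ← hz, mul_assoc, Rat.mul_den_eq_num]
    exact_mod_cast this
  have h2 : (p : ℤ) ∣ q.num :=
    (Nat.isCoprime_iff_coprime.2 hN.symm).dvd_of_dvd_mul_left ⟨_, h1⟩
  exact Int.natCast_dvd.1 h2

/-- The local algebra `ℚ ⊕ J` with `J ^ 3 = 0`, where `J = ℚ³ ⊕ ℚᵏ⁺²` and the product of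
`x, y, z ∈ ℚ³` is determined by `xz = zx = xy = u`, `yz = zy = v`, all other products being zero;
here `u` and `v` are the first two basis vectors of `ℚᵏ⁺²`. -/
def LocalAlg (k : ℕ) : Type := ℚ × (Fin 3 → ℚ) × (Fin (k + 2) → ℚ)

namespace LocalAlg

variable {k : ℕ}

instance : AddCommGroup (LocalAlg k) :=
  inferInstanceAs (AddCommGroup (ℚ × (Fin 3 → ℚ) × (Fin (k + 2) → ℚ)))

instance : Module ℚ (LocalAlg k) :=
  inferInstanceAs (Module ℚ (ℚ × (Fin 3 → ℚ) × (Fin (k + 2) → ℚ)))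

/-- The component in `ℚ`. -/
def const : LocalAlg k →ₗ[ℚ] ℚ := LinearMap.fst ℚ _ _

/-- The component in `ℚ³`. -/
def lin : LocalAlg k →ₗ[ℚ] (Fin 3 → ℚ) := LinearMap.fst ℚ _ _ ∘ₗ LinearMap.snd ℚ _ _

/-- The component in `ℚᵏ⁺²`. -/
def soc : LocalAlg k →ₗ[ℚ] (Fin (k + 2) → ℚ) := LinearMap.snd ℚ _ _ ∘ₗ LinearMap.snd ℚ _ _

/-- The element with the given components. -/
def mk (a : ℚ) (m : Fin 3 → ℚ) (s : Fin (k + 2) → ℚ) : LocalAlg k := (a, m, s)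

@[simp] theorem const_mk (a m s) : const (mk a m s : LocalAlg k) = a := rfl
@[simp] theorem lin_mk (a m s) : lin (mk a m s : LocalAlg k) = m := rfl
@[simp] theorem soc_mk (a m s) : soc (mk a m s : LocalAlg k) = s := rfl

@[ext]
theorem ext {v w : LocalAlg k} (h₁ : const v = const w) (h₂ : ∀ i, lin v i = lin w i)
    (h₃ : ∀ i, soc v i = soc w i) : v = w :=
  Prod.ext h₁ (Prod.ext (funext h₂) (funext h₃))

/-- The product `ℚ³ × ℚ³ → ℚᵏ⁺²`. -/
def linMul (m m' : Fin 3 → ℚ) : Fin (k + 2) → ℚ := fun i =>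
  (m 0 * m' 2 + m 2 * m' 0 + m 0 * m' 1) * (Pi.single 0 1 : Fin (k + 2) → ℚ) i +
    (m 1 * m' 2 + m 2 * m' 1) * (Pi.single 1 1 : Fin (k + 2) → ℚ) i

instance : Mul (LocalAlg k) where
  mul v w := mk (const v * const w) (const v • lin w + const w • lin v)
    (const v • soc w + const w • soc v + linMul (lin v) (lin w))

instance : One (LocalAlg k) where
  one := mk 1 0 0

@[simp] theorem const_one : const (1 : LocalAlg k) = 1 := rfl
@[simp] theorem lin_one : lin (1 : LocalAlg k) = 0 := rfl
@[simp] theorem soc_one : soc (1 : LocalAlg k) = 0 := rfl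

@[simp] theorem const_mul (v w : LocalAlg k) : const (v * w) = const v * const w := rfl

@[simp] theorem lin_mul (v w : LocalAlg k) (i : Fin 3) :
    lin (v * w) i = const v * lin w i + const w * lin v i := rfl

@[simp] theorem soc_mul (v w : LocalAlg k) (i : Fin (k + 2)) :
    soc (v * w) i = const v * soc w i + const w * soc v i + linMul (lin v) (lin w) i := rfl

instance : Ring (LocalAlg k) :=
  { (inferInstance : AddCommGroup (LocalAlg k)) with
    mul_assoc := fun a b c => by ext <;> simp [linMul] <;> ring
    one_mul := fun a => by ext <;> simp [linMul]
    mul_one := fun a => by ext <;> simp [linMul]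
    zero_mul := fun a => by ext <;> simp [linMul]
    mul_zero := fun a => by ext <;> simp [linMul]
    left_distrib := fun a b c => by ext <;> simp [linMul] <;> ring
    right_distrib := fun a b c => by ext <;> simp [linMul] <;> ring }

instance : Algebra ℚ (LocalAlg k) :=
  Algebra.ofModule (fun q v w => by ext <;> simp [linMul] <;> ring)
    (fun q v w => by ext <;> simp [linMul] <;> ring)

@[simp] theorem const_natCast (n : ℕ) : const (n : LocalAlg k) = n := by
  rw [← nsmul_one, map_nsmul, const_one, nsmul_one]

theorem finrank_eq : Module.finrank ℚ (LocalAlg k) = k + 6 := by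
  change Module.finrank ℚ (ℚ × (Fin 3 → ℚ) × (Fin (k + 2) → ℚ)) = k + 6
  simp
  ring

theorem single_mem_range_intCast {n : ℕ} (l i : Fin n) :
    (Pi.single l 1 : Fin n → ℚ) i ∈ (Int.castRingHom ℚ).range := by
  by_cases h : i = l
  · subst h
    simp
  · simp [h]

/-- The elements all of whose coordinates are integers. -/
def integral (k : ℕ) : Subring (LocalAlg k) where
  carrier := {v | const v ∈ (Int.castRingHom ℚ).range ∧
    (∀ i, lin v i ∈ (Int.castRingHom ℚ).range) ∧ ∀ i, soc v i ∈ (Int.castRingHom ℚ).range}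
  zero_mem' := by simp
  one_mem' := by simp
  add_mem' := by
    rintro v w ⟨hv, hv', hv''⟩ ⟨hw, hw', hw''⟩
    exact ⟨add_mem hv hw, fun i => add_mem (hv' i) (hw' i), fun i => add_mem (hv'' i) (hw'' i)⟩
  neg_mem' := by
    rintro v ⟨hv, hv', hv''⟩
    exact ⟨neg_mem hv, fun i => neg_mem (hv' i), fun i => neg_mem (hv'' i)⟩
  mul_mem' := by
    rintro v w ⟨hv, hv', hv''⟩ ⟨hw, hw', hw''⟩
    refine ⟨mul_mem hv hw, fun i => add_mem (mul_mem hv (hw' i)) (mul_mem hw (hv' i)), fun i =>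
      add_mem (add_mem (mul_mem hv (hw'' i)) (mul_mem hw (hv'' i)))
        (add_mem (mul_mem ?_ (single_mem_range_intCast 0 i)) (mul_mem ?_ (single_mem_range_intCast 1 i)))⟩
    · exact add_mem (add_mem (mul_mem (hv' 0) (hw' 2)) (mul_mem (hv' 2) (hw' 0)))
        (mul_mem (hv' 0) (hw' 1))
    · exact add_mem (mul_mem (hv' 1) (hw' 2)) (mul_mem (hv' 2) (hw' 1))

theorem exists_nsmul_mem_integral (v : LocalAlg k) : ∃ N : ℕ, N ≠ 0 ∧ N • v ∈ integral k := by
  have key : ∀ (q : ℚ) (N : ℕ), q.den ∣ N → N • q ∈ (Int.castRingHom ℚ).range := by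
    rintro q _ ⟨m, rfl⟩
    refine ⟨m * q.num, ?_⟩
    rw [nsmul_eq_mul]
    push_cast
    rw [mul_comm (q.den : ℚ), mul_assoc, Rat.den_mul_eq_num]
    simp
  refine ⟨(const v).den * ((∏ i, (lin v i).den) * ∏ i, (soc v i).den), ?_, ?_, fun i => ?_,
    fun i => ?_⟩
  · simp [Finset.prod_eq_zero_iff]
  · rw [map_nsmul]
    exact key _ _ (dvd_mul_right _ _)
  · rw [map_nsmul, Pi.smul_apply]
    exact key _ _ (((Finset.dvd_prod_of_mem (fun i => (lin v i).den)
      (Finset.mem_univ i)).mul_right _).mul_left _)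
  · rw [map_nsmul, Pi.smul_apply]
    exact key _ _ (((Finset.dvd_prod_of_mem (fun i => (soc v i).den)
      (Finset.mem_univ i)).mul_left _).mul_left _)

theorem isPrimeSeparated_integral : IsPrimeSeparated (integral k) := by
  intro v hv
  have key : ∀ f : LocalAlg k →+ ℚ, (∀ w ∈ integral k, f w ∈ (Int.castRingHom ℚ).range) →
      f v = 0 := by
    intro f hf
    refine Rat.eq_zero_of_infinite_primes (hv.mono ?_)
    rintro p ⟨hp, r, ⟨N, hN, hr⟩, rfl⟩
    obtain ⟨z, hz⟩ := hf _ hr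
    refine ⟨hp, N, hN, z, ?_⟩
    rw [map_nsmul, nsmul_eq_mul] at hz
    rw [map_nsmul, nsmul_eq_mul, mul_left_comm, ← hz]
    rfl
  ext i
  · exact key const.toAddMonoidHom fun w hw => hw.1
  · exact key ((Pi.evalAddMonoidHom (fun _ => ℚ) i).comp lin.toAddMonoidHom) fun w hw => hw.2.1 i
  · exact key ((Pi.evalAddMonoidHom (fun _ => ℚ) i).comp soc.toAddMonoidHom) fun w hw => hw.2.2 i

/-- The standard basis of the radical. -/
def radBasis : Fin 3 ⊕ Fin (k + 2) → LocalAlg k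
  | .inl i => mk 0 (Pi.single i 1) 0
  | .inr i => mk 0 0 (Pi.single i 1)

theorem const_radBasis (i : Fin 3 ⊕ Fin (k + 2)) : const (radBasis i) = 0 := by
  cases i <;> rfl

theorem radBasis_mem (i : Fin 3 ⊕ Fin (k + 2)) : radBasis i ∈ integral k := by
  rcases i with i | i
  · exact ⟨zero_mem _, fun l => single_mem_range_intCast i l, fun l => zero_mem _⟩
  · exact ⟨zero_mem _, fun l => zero_mem _, fun l => single_mem_range_intCast i l⟩

theorem radBasis_mul_self (i : Fin 3 ⊕ Fin (k + 2)) : radBasis i * radBasis i = 0 := by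
  rcases i with i | i
  · ext l
    · simp [radBasis]
    · simp [radBasis]
    · fin_cases i <;> simp [radBasis, linMul]
  · ext l <;> simp [radBasis, linMul]

theorem integral_le_closure :
    (integral k).toAddSubgroup ≤ AddSubgroup.closure (insert 1 (Set.range radBasis)) := by
  rintro v ⟨⟨a, ha⟩, hm, hs⟩
  choose m hm using hm
  choose s hs using hs
  have hv : v = a • (1 : LocalAlg k) + (∑ i, m i • radBasis (.inl i) +
      ∑ i, s i • radBasis (.inr i)) := by
    ext l <;> simp only [map_add, map_sum, map_zsmul]
    · simp [← ha, const_radBasis]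
    · simp [← hm, radBasis, Finset.sum_apply, Pi.single_apply]
    · simp [← hs, radBasis, Finset.sum_apply, Pi.single_apply]
  rw [hv]
  refine add_mem (zsmul_mem (AddSubgroup.subset_closure (Set.mem_insert _ _)) _)
    (add_mem (sum_mem fun i _ => zsmul_mem ?_ _) (sum_mem fun i _ => zsmul_mem ?_ _)) <;>
  exact AddSubgroup.subset_closure (Set.mem_insert_of_mem _ (Set.mem_range_self _))

theorem mem_center_of_lin {v : integral k} (h₀ : lin (v : LocalAlg k) 0 = 0)
    (h₁ : lin (v : LocalAlg k) 1 = 0) : v ∈ Subring.center (integral k) := by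
  refine Subring.mem_center_iff.2 fun w => Subtype.ext ?_
  ext i
  · simp [mul_comm]
  · simp [add_comm]
  · simp [linMul, h₀, h₁]
    ring

theorem isCentrallyEssential_integral : IsCentrallyEssential (integral k) := by
  intro a ha
  by_cases h0 : const (a : LocalAlg k) = 0
  · by_cases hm : lin (a : LocalAlg k) 0 = 0 ∧ lin (a : LocalAlg k) 1 = 0
    · exact ⟨1, a, one_mem _, mem_center_of_lin hm.1 hm.2,
        fun h => ha (by rw [← mul_one a, h, mul_zero]), ha, mul_one a⟩
    · have hne : a * ⟨radBasis (.inl 2), radBasis_mem _⟩ ≠ 0 := by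
        intro h
        have h' := congrArg Subtype.val h
        have e0 := congrArg (fun v : LocalAlg k => soc v 0) h'
        have e1 := congrArg (fun v : LocalAlg k => soc v 1) h'
        simp [radBasis, linMul] at e0 e1
        exact hm ⟨e0, e1⟩
      refine ⟨⟨radBasis (.inl 2), radBasis_mem _⟩, _, mem_center_of_lin ?_ ?_,
        mem_center_of_lin ?_ ?_, fun h => hne (by rw [h, mul_zero]), hne, rfl⟩ <;>
      simp [radBasis, h0]
  · have hne : a * ⟨radBasis (.inr 0), radBasis_mem _⟩ ≠ 0 := by
      intro h
      have e0 := congrArg (fun v : integral k => soc (v : LocalAlg k) 0) h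
      simp [radBasis, linMul] at e0
      exact h0 e0
    refine ⟨⟨radBasis (.inr 0), radBasis_mem _⟩, _, mem_center_of_lin ?_ ?_,
      mem_center_of_lin ?_ ?_, fun h => hne (by rw [h, mul_zero]), hne, rfl⟩ <;>
    simp [radBasis]

theorem exists_isRightIdeal_not_isLeftIdeal_integral :
    ∃ I : AddSubgroup (integral k), IsRightIdeal I ∧ ¬ IsLeftIdeal I := by
  let I : AddSubgroup (integral k) :=
    { carrier := {v | const (v : LocalAlg k) = 0 ∧ lin (v : LocalAlg k) 0 = 0 ∧
        lin (v : LocalAlg k) 2 = 0 ∧ soc (v : LocalAlg k) 0 = 0}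
      zero_mem' := by simp
      add_mem' := by
        rintro v w ⟨h1, h2, h3, h4⟩ ⟨h1', h2', h3', h4'⟩
        simp [*]
      neg_mem' := by
        rintro v ⟨h1, h2, h3, h4⟩
        simp [*] }
  refine ⟨I, ?_, fun h => ?_⟩
  · rintro v ⟨h1, h2, h3, h4⟩ w
    refine ⟨?_, ?_, ?_, ?_⟩ <;> simp [linMul, h1, h2, h3, h4]
  · have hy : (⟨radBasis (.inl 1), radBasis_mem _⟩ : integral k) ∈ I := by
      refine ⟨?_, ?_, ?_, ?_⟩ <;> simp [radBasis]
    have := (h _ hy ⟨radBasis (.inl 0), radBasis_mem _⟩).2.2.2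
    simp [radBasis, linMul] at this

theorem isUnit_of_const_eq_one {v : integral k} (h : const (v : LocalAlg k) = 1) : IsUnit v := by
  have hnil : IsNilpotent (v - 1) := by
    refine ⟨3, Subtype.ext ?_⟩
    rw [pow_succ, sq]
    ext i <;> simp [linMul, h]
  simpa using hnil.isUnit_add_one

theorem twist_faithful {j : ℕ → LocalAlg k} (hj : ∀ p, j p ∈ integral k)
    (hj2 : ∀ p, j p * j p = 0) (hj0 : ∀ p, const (j p) = 0)
    (hsurj : Function.Surjective (twistLeftMul (integral k) j))
    (I : AddSubgroup (AddMonoid.End (twist (integral k) j))) (hI : IsRightIdeal I) (hne : I ≠ ⊤) :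
    AddSubgroup.closure {x : twist (integral k) j | ∃ φ ∈ I, ∃ a, x = φ a} ≠ ⊤ := by
  intro htop
  -- the constant terms of elements of `I`
  let C : AddSubgroup ℤ := ((I.comap (twistLeftMul (integral k) j).toAddMonoidHom).map
    ((const : LocalAlg k →ₗ[ℚ] ℚ).toAddMonoidHom.comp (integral k).subtype.toAddMonoidHom)).comap
      (Int.castAddHom ℚ)
  have hC : (1 : ℤ) ∉ C := by
    rintro ⟨r, hr, hr1⟩
    obtain ⟨u, hu⟩ := (isUnit_of_const_eq_one (v := r) (by simpa using hr1)).exists_right_inv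
    refine hne ((AddSubgroup.eq_top_iff' I).2 fun ψ => ?_)
    have h1 := hI _ hr (twistLeftMul (integral k) j u * ψ)
    have h2 : twistLeftMul (integral k) j r * twistLeftMul (integral k) j u = 1 := by
      rw [← map_mul, hu, map_one]
    change twistLeftMul (integral k) j r * _ ∈ I at h1
    rwa [← mul_assoc, h2, one_mul] at h1
  obtain ⟨p, hp, hpC⟩ : ∃ p : ℕ, p.Prime ∧ ∀ z ∈ C, (p : ℤ) ∣ z := by
    obtain ⟨d, hd⟩ := Int.subgroup_cyclic C
    rw [← AddSubgroup.zmultiples_eq_closure] at hd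
    have hd1 : d.natAbs ≠ 1 := fun h => hC <| by
      rw [hd, Int.mem_zmultiples_iff]
      exact (Int.isUnit_iff_natAbs_eq.2 h).dvd
    refine ⟨_, Nat.minFac_prime hd1, fun z hz => ?_⟩
    rw [hd, Int.mem_zmultiples_iff] at hz
    exact (Int.natCast_dvd.2 (Nat.minFac_dvd _)).trans hz
  have hle : AddSubgroup.closure {x : twist (integral k) j | ∃ φ ∈ I, ∃ a, x = φ a} ≤
      ((Int.castAddHom ℚ).range.localAt p).comap
        ((const : LocalAlg k →ₗ[ℚ] ℚ).toAddMonoidHom.comp (twist (integral k) j).subtype) := by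
    rw [AddSubgroup.closure_le]
    rintro _ ⟨φ, hφ, a, rfl⟩
    obtain ⟨r, rfl⟩ := hsurj φ
    obtain ⟨c, hc⟩ := r.2.1
    obtain ⟨z, rfl⟩ := hpC c ⟨r, hφ, hc.symm⟩
    obtain ⟨N, hN, ⟨w, hw⟩, -⟩ := a.2 p hp
    refine ⟨N, hN, -(z * w), ?_⟩
    have hc' : const (r : LocalAlg k) = p * z := by simpa using hc.symm
    have hw' : (w : ℚ) = -(N * (const (a : LocalAlg k) * p)) := by
      rw [map_nsmul, nsmul_eq_mul] at hw
      simpa [hj0] using hw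
    change ((-(z * w) : ℤ) : ℚ) = N • const (r * a : LocalAlg k)
    rw [const_mul, hc', nsmul_eq_mul]
    push_cast
    rw [hw']
    ring
  have hτ : (⟨_, twistUnit_mem hj hj2 hp⟩ : twist (integral k) j) ∈ (⊤ : AddSubgroup _) :=
    AddSubgroup.mem_top _
  rw [← htop] at hτ
  obtain ⟨N, hN, z, hz⟩ := hle hτ
  have h := congrArg const (sq_nsmul_twistUnit (j := j) hp)
  rw [map_nsmul, map_add, hj0, const_natCast, zero_add, nsmul_eq_mul] at h
  replace hz : (z : ℚ) = N * const (twistUnit j p) := by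
    rw [← nsmul_eq_mul]
    exact hz
  have hp0 : (p : ℚ) ≠ 0 := Nat.cast_ne_zero.2 hp.ne_zero
  have hNz : (N : ℚ) = p * z := by
    refine mul_left_cancel₀ hp0 ?_
    rw [hz]
    push_cast at h
    linear_combination -(N : ℚ) * h
  have hdvd : (p : ℤ) ∣ N := ⟨z, by exact_mod_cast hNz⟩
  exact (Nat.Prime.coprime_iff_not_dvd hp).1 hN.symm (Int.natCast_dvd_natCast.1 hdvd)

end LocalAlg

/-- Corollary 4.4: for every `n ≥ 7` there is a torsion-free abelian group `A` of
rank `n` whose endomorphism ring is centrally essential and not right invariant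
(it has a right ideal that is not two-sided), and `A` is faithful. -/
theorem exists_faithful_group_centrallyEssential_not_invariant :
    ∀ n : ℕ, 7 ≤ n →
      ∃ (A : Type) (_ : AddCommGroup A),
        (∀ (m : ℤ) (a : A), m ≠ 0 → m • a = 0 → a = 0) ∧
        Module.finrank ℚ (ℚ ⊗[ℤ] A) = n ∧
        IsCentrallyEssential (AddMonoid.End A) ∧
        (∃ I : AddSubgroup (AddMonoid.End A), IsRightIdeal I ∧ ¬ IsLeftIdeal I) ∧
        (∀ I : AddSubgroup (AddMonoid.End A), IsRightIdeal I → I ≠ ⊤ →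
          AddSubgroup.closure {x : A | ∃ φ ∈ I, ∃ a : A, x = φ a} ≠ ⊤) := by
  intro n hn
  obtain ⟨k, rfl⟩ : ∃ k, n = k + 6 := ⟨n - 6, by omega⟩
  obtain ⟨e, he⟩ := exists_infinite_primes_fiber (ι := Fin 3 ⊕ Fin (k + 2))
  let j : ℕ → LocalAlg k := fun p => LocalAlg.radBasis (e p)
  have hj : ∀ p, j p ∈ LocalAlg.integral k := fun p => LocalAlg.radBasis_mem _
  have hj2 : ∀ p, j p * j p = 0 := fun p => LocalAlg.radBasis_mul_self _
  have hsurj : Function.Surjective (twistLeftMul (LocalAlg.integral k) j) := by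
    refine twistLeftMul_surjective hj hj2 LocalAlg.exists_nsmul_mem_integral
      LocalAlg.isPrimeSeparated_integral (LocalAlg.integral_le_closure.trans
        (AddSubgroup.closure_mono (Set.insert_subset_insert ?_)))
    rintro _ ⟨i, rfl⟩
    exact (he i).mono fun p hp => ⟨hp.1, congrArg LocalAlg.radBasis hp.2⟩
  let E := RingEquiv.ofBijective (twistLeftMul (LocalAlg.integral k) j)
    ⟨twistLeftMul_injective hj, hsurj⟩
  refine ⟨twist (LocalAlg.integral k) j, inferInstance, fun m a hm h => ?_, ?_,
    LocalAlg.isCentrallyEssential_integral.of_ringEquiv E,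
    exists_isRightIdeal_not_isLeftIdeal_of_ringEquiv E
      LocalAlg.exists_isRightIdeal_not_isLeftIdeal_integral,
    LocalAlg.twist_faithful hj hj2 (fun p => LocalAlg.const_radBasis _) hsurj⟩
  · have h' : (m : ℚ) • (a : LocalAlg k) = 0 := by
      rw [Int.cast_smul_eq_zsmul]
      exact congrArg Subtype.val h
    exact Subtype.ext ((smul_eq_zero.1 h').resolve_left (Int.cast_ne_zero.2 hm))
  · rw [finrank_tensor_twist hj LocalAlg.exists_nsmul_mem_integral, LocalAlg.finrank_eq]
end
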